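/- Let K be a field, n ≥ 2 an integer, and A an n×n matrix over K. Let σ₁ : Mₙ(K) → K be a K-linear functional with σ₁(Id) = 0 and σ₁(A) ≠ 0, and let s₂, …, s_{n−1} ∈ K be scalars satisfying, for each integer m with 2 ≤ m ≤ n−1, the recursion σ₁(A^m) = σ₁(A)·tr(Sym^{m−1} A) + Σ_{j=2}^{m} (−1)^{j−1} s_j · tr(Sym^{m−j} A). Then for every integer k ≥ 0, tr(Sym^k A) = (1/σ₁(A)) · [ σ₁(A^{k+1}) + Σ_{j=2}^{n−1} (−1)^{j} s_j · tr(Sym^{k+1−j} A) ]. -/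

import Mathlib

open MvPolynomial Finset

/-- The endomorphism induced by the matrix `A` on the space of homogeneous polynomials of
degree `k` in `n` variables (a model for the `k`-th symmetric power of `K^n`). -/
noncomputable def symPowMap {K : Type*} [Field K] {n : ℕ} (A : Matrix (Fin n) (Fin n) K) (k : ℕ) :
    homogeneousSubmodule (Fin n) K k →ₗ[K] homogeneousSubmodule (Fin n) K k :=
  LinearMap.restrict
    (MvPolynomial.aeval fun i => ∑ j, A i j • X j :
      MvPolynomial (Fin n) K →ₐ[K] MvPolynomial (Fin n) K).toLinearMap
    (fun p hp => by
      rw [mem_homogeneousSubmodule] at hp ⊢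
      have hg : ∀ i : Fin n, (∑ j, A i j • X j : MvPolynomial (Fin n) K).IsHomogeneous 1 := by
        intro i
        apply IsHomogeneous.sum
        intro j _
        rw [smul_eq_C_mul]
        exact (isHomogeneous_X K j).C_mul (A i j)
      have := hp.aeval (fun i => ∑ j, A i j • X j) hg
      simpa using this)

/-- `trSymPow A k = tr(Sym^k A)`, the trace of the `k`-th symmetric power of `A`. -/
noncomputable def trSymPow {K : Type*} [Field K] {n : ℕ} (A : Matrix (Fin n) (Fin n) K)
    (k : ℕ) : K :=
  LinearMap.trace K _ (symPowMap A k)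

/-- `tr(Sym^k A)` for an integer index, with the convention `tr(Sym^k A) = 0` for `k < 0`. -/
noncomputable def trSymPowZ {K : Type*} [Field K] {n : ℕ} (A : Matrix (Fin n) (Fin n) K)
    (k : ℤ) : K :=
  if 0 ≤ k then trSymPow A k.toNat else 0

/-- The substitution `X i ↦ ∑ j, A i j X j` on polynomials. -/
noncomputable def linearSubst {R : Type*} [CommRing R] {n : ℕ} (A : Matrix (Fin n) (Fin n) R) :
    MvPolynomial (Fin n) R →ₐ[R] MvPolynomial (Fin n) R :=
  aeval fun i => ∑ j, A i j • X j

/-- The sum of the diagonal coefficients of `linearSubst A` on monomials of degree `k`. -/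
noncomputable def diagCoeffSum {R : Type*} [CommRing R] {n : ℕ} (A : Matrix (Fin n) (Fin n) R)
    (k : ℕ) : R :=
  ∑ d ∈ finsuppAntidiag univ k, coeff d (linearSubst A (monomial d 1))

theorem linearSubst_X {R : Type*} [CommRing R] {n : ℕ} (A : Matrix (Fin n) (Fin n) R)
    (i : Fin n) : linearSubst A (X i) = ∑ j, A i j • X j := by
  simp [linearSubst]

theorem linearSubst_comp {R : Type*} [CommRing R] {n : ℕ} (A B : Matrix (Fin n) (Fin n) R) :
    (linearSubst B).comp (linearSubst A) = linearSubst (A * B) := by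
  ext1 i
  simp only [AlgHom.comp_apply, linearSubst_X, map_sum, map_smul, Matrix.mul_apply,
    Finset.smul_sum, Finset.sum_smul, smul_smul]
  exact Finset.sum_comm

theorem symPowMap_coe {K : Type*} [Field K] {n : ℕ} (A : Matrix (Fin n) (Fin n) K) (k : ℕ)
    (p : homogeneousSubmodule (Fin n) K k) :
    (symPowMap A k p : MvPolynomial (Fin n) K) = linearSubst A p := rfl

theorem symPowMap_mul {K : Type*} [Field K] {n : ℕ} (A B : Matrix (Fin n) (Fin n) K) (k : ℕ) :
    symPowMap (A * B) k = symPowMap B k * symPowMap A k := by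
  ext1 p
  apply Subtype.ext
  simp only [Module.End.mul_apply, symPowMap_coe, ← linearSubst_comp, AlgHom.comp_apply]

theorem trSymPow_units_conj {K : Type*} [Field K] {n : ℕ} (P : (Matrix (Fin n) (Fin n) K)ˣ)
    (A : Matrix (Fin n) (Fin n) K) (k : ℕ) :
    trSymPow (P.val * A * P⁻¹.val) k = trSymPow A k := by
  rw [trSymPow, symPowMap_mul, LinearMap.trace_mul_comm, ← symPowMap_mul, ← mul_assoc,
    Units.inv_mul, one_mul, trSymPow]

theorem trSymPow_eq_diagCoeffSum {K : Type*} [Field K] {n : ℕ} (A : Matrix (Fin n) (Fin n) K)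
    (k : ℕ) : trSymPow A k = diagCoeffSum A k := by
  classical
  let s : Set (Fin n →₀ ℕ) := {d | d.degree = k}
  have hs : homogeneousSubmodule (Fin n) K k = restrictSupport K s :=
    homogeneousSubmodule_eq_finsupp_supported _ _ k
  have hmem (d : Fin n →₀ ℕ) : d ∈ finsuppAntidiag univ k ↔ d ∈ s := by
    simp [s, Finsupp.degree_eq_sum]
  let b : Module.Basis s K (homogeneousSubmodule (Fin n) K k) :=
    (basisRestrictSupport K s).map (LinearEquiv.ofEq _ _ hs.symm)
  have hrepr (p : homogeneousSubmodule (Fin n) K k) (d : s) :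
      b.repr p d = coeff d.1 (p : MvPolynomial (Fin n) K) := rfl
  have hb (d : s) : (b d : MvPolynomial (Fin n) K) = monomial d.1 1 := by
    ext e
    by_cases he : e ∈ s
    · rw [← hrepr _ ⟨e, he⟩, b.repr_self, coeff_monomial, Finsupp.single_apply]
      simp [Subtype.ext_iff]
    · rw [coeff_monomial, if_neg (by rintro rfl; exact he d.2)]
      by_contra h
      exact he (by
        have := (mem_homogeneousSubmodule _ _).1 (b d).2 h
        have hd := DFunLike.congr_fun (Finsupp.degree_eq_weight_one (R := ℕ) (σ := Fin n)) e
        exact hd.trans this)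
  let : Fintype s := Fintype.subtype (finsuppAntidiag univ k) hmem
  rw [trSymPow, LinearMap.trace_eq_matrix_trace K b, Matrix.trace, diagCoeffSum,
    Finset.sum_subtype _ hmem]
  refine Finset.sum_congr rfl fun d _ => ?_
  rw [Matrix.diag_apply, LinearMap.toMatrix_apply, hrepr, symPowMap_coe, hb]

theorem diagCoeffSum_map {R S : Type*} [CommRing R] [CommRing S] (f : R →+* S) {n : ℕ}
    (A : Matrix (Fin n) (Fin n) R) (k : ℕ) :
    diagCoeffSum (A.map f) k = f (diagCoeffSum A k) := by
  have h (p : MvPolynomial (Fin n) R) :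
      linearSubst (A.map f) (MvPolynomial.map f p) = MvPolynomial.map f (linearSubst A p) := by
    induction p using MvPolynomial.induction_on with
    | C a => simp [linearSubst]
    | add p q hp hq => simp only [map_add, hp, hq]
    | mul_X p i hp => simp [map_mul, hp, linearSubst_X, smul_eq_C_mul]
  rw [diagCoeffSum, diagCoeffSum, map_sum]
  refine Finset.sum_congr rfl fun d _ => ?_
  rw [← coeff_map, ← h, map_monomial, f.map_one]

theorem diagCoeffSum_zero {R : Type*} [CommRing R] {n : ℕ} (A : Matrix (Fin n) (Fin n) R) :
    diagCoeffSum A 0 = 1 := by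
  simp [diagCoeffSum]

theorem sum_finsuppAntidiag_fin_succ {M : Type*} [AddCommMonoid M] {n : ℕ} (k : ℕ)
    (f : (Fin (n + 1) →₀ ℕ) → M) :
    ∑ d ∈ finsuppAntidiag univ (k + 1), f d =
      ∑ d ∈ finsuppAntidiag univ k, f (d + Finsupp.single 0 1) +
        ∑ d ∈ finsuppAntidiag (univ : Finset (Fin n)) (k + 1), f (d.cons 0) := by
  rw [← Finset.sum_filter_not_add_sum_filter _ (fun d => d 0 = 0)]
  congr 1
  · symm
    refine Finset.sum_nbij' (fun d => d + Finsupp.single 0 1) (fun d => d - Finsupp.single 0 1)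
      ?_ ?_ ?_ ?_ ?_
    · intro d hd
      simp_all [Finset.sum_add_distrib]
    · intro d hd
      simp only [mem_filter, mem_finsuppAntidiag, subset_univ, and_true, Fin.sum_univ_succ] at hd ⊢
      simp
      omega
    · intro d _; simp
    · intro d hd
      simp only [mem_filter] at hd
      refine tsub_add_cancel_of_le ?_
      simpa [Nat.one_le_iff_ne_zero] using hd.2
    · intro d _; rfl
  · symm
    refine Finset.sum_nbij' (fun d => d.cons 0) (fun d => d.tail) ?_ ?_ ?_ ?_ ?_
    · intro d hd
      simp_all [Fin.sum_univ_succ]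
    · intro d hd
      simp only [mem_filter, mem_finsuppAntidiag, subset_univ, and_true, Fin.sum_univ_succ] at hd ⊢
      rw [hd.2, zero_add] at hd
      exact hd.1
    · intro d _; simp
    · intro d hd
      simp only [mem_filter] at hd
      conv_rhs => rw [← Finsupp.cons_tail d, hd.2]
    · intro d _; rfl

theorem diagCoeffSum_succ_of_row_zero {R : Type*} [CommRing R] {n : ℕ}
    (B : Matrix (Fin (n + 1)) (Fin (n + 1)) R) (hB : ∀ j : Fin n, B 0 j.succ = 0) (k : ℕ) :
    diagCoeffSum B (k + 1) =
      B 0 0 * diagCoeffSum B k + diagCoeffSum (B.submatrix Fin.succ Fin.succ) (k + 1) := by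
  have hX : linearSubst B (X 0) = B 0 0 • X 0 := by
    simp [linearSubst_X, Fin.sum_univ_succ, hB]
  rw [diagCoeffSum, sum_finsuppAntidiag_fin_succ, diagCoeffSum, diagCoeffSum, Finset.mul_sum]
  congr 1
  · refine Finset.sum_congr rfl fun d _ => ?_
    rw [show monomial (d + Finsupp.single 0 1) (1 : R) = monomial d 1 * X 0 by
      simp [X, monomial_mul], map_mul, hX, mul_smul_comm, coeff_smul, smul_eq_mul, coeff_mul_X]
  · refine Finset.sum_congr rfl fun d _ => ?_
    rw [← finSuccEquiv_coeff_coeff]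
    congr 1
    have h : ∀ p : MvPolynomial (Fin n) R,
        (finSuccEquiv R n (linearSubst B (rename Fin.succ p))).coeff 0 =
          linearSubst (B.submatrix Fin.succ Fin.succ) p := by
      intro p
      induction p using MvPolynomial.induction_on with
      | C a => simp [linearSubst, finSuccEquiv_apply]
      | add p q hp hq => simp only [map_add, Polynomial.coeff_add, hp, hq]
      | mul_X p i hp =>
        simp only [map_mul, rename_X, Polynomial.mul_coeff_zero, hp]
        simp [linearSubst_X, Fin.sum_univ_succ, smul_eq_C_mul,
          finSuccEquiv_apply]
    rw [← h, rename_monomial]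
    congr
    ext i
    refine Fin.cases ?_ (fun j => ?_) i
    · rw [Finsupp.cons_zero, Finsupp.mapDomain_of_notMem_range]
      simp
    · rw [Finsupp.cons_succ, Finsupp.mapDomain_apply (Fin.succ_injective n)]

theorem charpolyRev_of_row_zero {R : Type*} [CommRing R] {n : ℕ}
    (B : Matrix (Fin (n + 1)) (Fin (n + 1)) R) (hB : ∀ j : Fin n, B 0 j.succ = 0) :
    B.charpolyRev = (1 - Polynomial.C (B 0 0) * Polynomial.X) *
      (B.submatrix Fin.succ Fin.succ).charpolyRev := by
  rw [Matrix.charpolyRev, Matrix.det_succ_row_zero, Fin.sum_univ_succ]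
  rw [Finset.sum_eq_zero, add_zero, Matrix.charpolyRev]
  · have : (1 - (Polynomial.X : Polynomial R) • B.map Polynomial.C).submatrix Fin.succ
        (Fin.succAbove 0) = 1 - (Polynomial.X : Polynomial R) •
          (B.submatrix Fin.succ Fin.succ).map Polynomial.C := by
      ext1 i j
      simp [Matrix.one_apply]
    rw [this]
    simp [Polynomial.X_mul_C]
  · intro j _
    simp [hB, (Fin.succ_ne_zero j).symm]

/-- Over an algebraically closed field every matrix is conjugate to one whose first row is
supported on the first entry. -/
theorem exists_units_conj_row_zero {K : Type*} [Field K] [IsAlgClosed K] {n : ℕ}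
    (A : Matrix (Fin (n + 1)) (Fin (n + 1)) K) :
    ∃ P : (Matrix (Fin (n + 1)) (Fin (n + 1)) K)ˣ,
      ∀ j : Fin n, (P.val * A * P⁻¹.val) 0 j.succ = 0 := by
  obtain ⟨μ, hμ⟩ := Module.End.exists_eigenvalue (Matrix.toLin' A.transpose)
  obtain ⟨c, hc⟩ := hμ.exists_hasEigenvector
  have hcA : Matrix.vecMul c A = μ • c := by
    simpa [Matrix.mulVec_transpose] using hc.apply_eq_smul
  obtain ⟨i, hi⟩ := Function.ne_iff.1 hc.2
  let Q : Matrix (Fin (n + 1)) (Fin (n + 1)) K :=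
    (Matrix.updateRow 1 i c).submatrix (Equiv.swap 0 i) id
  have hQ : IsUnit Q := by
    rw [Matrix.isUnit_iff_isUnit_det, Matrix.det_permute, ← Matrix.cramer_transpose_apply,
      Matrix.transpose_one, Matrix.cramer_one]
    exact ((Equiv.Perm.sign _).isUnit.map (Int.castRingHom K)).mul (IsUnit.mk0 _ hi)
  obtain ⟨P, hP⟩ := hQ
  refine ⟨P, fun j => ?_⟩
  have hrow : P.val 0 = c := by
    rw [hP]; ext j; simp [Q]
  have h1 : (P.val * A) 0 = μ • P.val 0 := by
    rw [Matrix.mul_apply_eq_vecMul, hrow, hcA]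
  rw [Matrix.mul_apply_eq_vecMul, h1, Matrix.smul_vecMul, ← Matrix.mul_apply_eq_vecMul,
    Units.mul_inv]
  simp [(Fin.succ_ne_zero j).symm]

theorem mk_trSymPow_mul_charpolyRev_of_isAlgClosed {K : Type*} [Field K] [IsAlgClosed K] {n : ℕ}
    (A : Matrix (Fin n) (Fin n) K) :
    PowerSeries.mk (trSymPow A) * (A.charpolyRev : PowerSeries K) = 1 := by
  induction n with
  | zero =>
    have h : PowerSeries.mk (trSymPow A) = 1 := by
      ext k
      rw [PowerSeries.coeff_mk, trSymPow_eq_diagCoeffSum, PowerSeries.coeff_one]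
      rcases k with _ | k
      · simp [diagCoeffSum_zero]
      · simp [diagCoeffSum]
    simp [h, Matrix.charpolyRev]
  | succ n ih =>
    obtain ⟨P, hP⟩ := exists_units_conj_row_zero A
    set B := P.val * A * P⁻¹.val with hB
    have hχ : A.charpolyRev = B.charpolyRev := by
      rw [← Matrix.reverse_charpoly, ← Matrix.reverse_charpoly, hB, Matrix.coe_units_inv,
        Matrix.charpoly_units_conj]
    have hH : PowerSeries.mk (trSymPow A) * (1 - PowerSeries.C (B 0 0) * PowerSeries.X) =
        PowerSeries.mk (trSymPow (B.submatrix Fin.succ Fin.succ)) := by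
      have hAB : trSymPow A = diagCoeffSum B := by
        ext k
        rw [← trSymPow_eq_diagCoeffSum, hB, trSymPow_units_conj]
      ext k
      rw [hAB, mul_sub, mul_one, mul_left_comm, map_sub, PowerSeries.coeff_C_mul,
        PowerSeries.coeff_mk, PowerSeries.coeff_mk, trSymPow_eq_diagCoeffSum]
      rcases k with _ | k
      · simp [diagCoeffSum_zero]
      · rw [PowerSeries.coeff_succ_mul_X, PowerSeries.coeff_mk,
          diagCoeffSum_succ_of_row_zero B hP, add_sub_cancel_left]
    rw [hχ, charpolyRev_of_row_zero B hP, Polynomial.coe_mul, ← mul_assoc]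
    simpa [hH] using ih (B.submatrix Fin.succ Fin.succ)

/-- The traces of the symmetric powers of `A` have generating series `1 / det (1 - t A)`. -/
theorem mk_trSymPow_mul_charpolyRev {K : Type*} [Field K] {n : ℕ}
    (A : Matrix (Fin n) (Fin n) K) :
    PowerSeries.mk (trSymPow A) * (A.charpolyRev : PowerSeries K) = 1 := by
  let f := algebraMap K (AlgebraicClosure K)
  have h := mk_trSymPow_mul_charpolyRev_of_isAlgClosed (A.map f)
  apply PowerSeries.map_injective f f.injective
  have hH : PowerSeries.map f (PowerSeries.mk (trSymPow A)) =
      PowerSeries.mk (trSymPow (A.map f)) := by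
    ext k
    simp [trSymPow_eq_diagCoeffSum, diagCoeffSum_map]
  have hχ : (A.map f).charpolyRev = A.charpolyRev.map f := by
    rw [← Matrix.reverse_charpoly, ← Matrix.reverse_charpoly, Matrix.charpoly_map,
      Polynomial.reverse, Polynomial.reverse, Polynomial.reflect_map, Polynomial.natDegree_map]
  rw [map_mul, map_one, hH, ← h, hχ, Polynomial.polynomial_map_coe]

theorem coeff_mk_pow_mul_charpolyRev {K : Type*} [Field K] {n : ℕ}
    (A : Matrix (Fin n) (Fin n) K) (σ : Matrix (Fin n) (Fin n) K →ₗ[K] K) {m : ℕ} (hm : n ≤ m) :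
    PowerSeries.coeff m (PowerSeries.mk (fun i => σ (A ^ i)) * (A.charpolyRev : PowerSeries K)) =
      0 := by
  have hdeg : A.charpoly.natDegree = n := by simp
  have hzero : ∀ j ∈ range (m + 1), j ∉ range (n + 1) →
      A.charpolyRev.coeff j * σ (A ^ (m - j)) = 0 := by
    intro j _ hj
    rw [← Matrix.reverse_charpoly, Polynomial.coeff_eq_zero_of_natDegree_lt, zero_mul]
    have := Polynomial.reverse_natDegree_le A.charpoly
    simp only [mem_range] at hj
    omega
  rw [mul_comm, PowerSeries.coeff_mul, Finset.Nat.sum_antidiagonal_eq_sum_range_succ_mk]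
  simp only [Polynomial.coeff_coe, PowerSeries.coeff_mk]
  rw [← Finset.sum_subset (Finset.range_mono (by omega)) hzero, ← Finset.sum_flip]
  have hterm : ∀ i ∈ range (n + 1), A.charpolyRev.coeff (n - i) * σ (A ^ (m - (n - i))) =
      σ (A ^ (m - n) * A.charpoly.coeff i • A ^ i) := by
    intro i hi
    simp only [mem_range] at hi
    rw [mul_smul_comm, map_smul, ← pow_add, smul_eq_mul, ← Matrix.reverse_charpoly,
      Polynomial.coeff_reverse, hdeg, Polynomial.revAt_le (by omega),
      show n - (n - i) = i by omega, show m - (n - i) = m - n + i by omega]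
  rw [Finset.sum_congr rfl hterm, ← map_sum, ← Finset.mul_sum]
  have := A.aeval_self_charpoly
  rw [Polynomial.aeval_eq_sum_range, hdeg] at this
  rw [this, mul_zero, map_zero]

theorem trSymPowZ_natCast_sub {K : Type*} [Field K] {n : ℕ} (A : Matrix (Fin n) (Fin n) K)
    {m j : ℕ} (h : j ≤ m) : trSymPowZ A ((m : ℤ) - j) = trSymPow A (m - j) := by
  rw [← Nat.cast_sub h]
  simp [trSymPowZ]

theorem trSymPowZ_of_neg {K : Type*} [Field K] {n : ℕ} (A : Matrix (Fin n) (Fin n) K)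
    {k : ℤ} (h : k < 0) : trSymPowZ A k = 0 := if_neg (by omega)

theorem trSymPow_zero {K : Type*} [Field K] {n : ℕ} (A : Matrix (Fin n) (Fin n) K) :
    trSymPow A 0 = 1 := by
  rw [trSymPow_eq_diagCoeffSum, diagCoeffSum_zero]

/-- Expansion of `σ (A ^ m)` along the traces of symmetric powers of `A`, with coefficients
those of the polynomial `det (1 - t A) * ∑ σ (A ^ i) t ^ i`. -/
theorem map_pow_eq_sum_trSymPowZ {K : Type*} [Field K] {n : ℕ} (A : Matrix (Fin n) (Fin n) K)
    (σ : Matrix (Fin n) (Fin n) K →ₗ[K] K) (h1 : σ 1 = 0) :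
    ∃ p : ℕ → K, (∀ m, n ≤ m → p m = 0) ∧ ∀ m : ℕ, 1 ≤ m → σ (A ^ m) =
      σ A * trSymPowZ A ((m : ℤ) - 1) +
        ∑ j ∈ Finset.Icc 2 m, p j * trSymPowZ A ((m : ℤ) - (j : ℤ)) := by
  set F : PowerSeries K := PowerSeries.mk fun i => σ (A ^ i) with hF
  set q := F * (A.charpolyRev : PowerSeries K) with hq
  have hFq : F = q * PowerSeries.mk (trSymPow A) := by
    rw [hq, mul_assoc, mul_comm (A.charpolyRev : PowerSeries K), mk_trSymPow_mul_charpolyRev,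
      mul_one]
  have hexp (m : ℕ) : σ (A ^ m) =
      ∑ j ∈ range (m + 1), PowerSeries.coeff j q * trSymPow A (m - j) := by
    have := congrArg (PowerSeries.coeff m) hFq
    rw [PowerSeries.coeff_mul, Finset.Nat.sum_antidiagonal_eq_sum_range_succ_mk] at this
    simpa [hF] using this
  have hq0 : PowerSeries.coeff 0 q = 0 := by
    simpa [h1, trSymPow_zero] using (hexp 0).symm
  have hq1 : PowerSeries.coeff 1 q = σ A := by
    simpa [Finset.sum_range_succ, hq0, trSymPow_zero] using (hexp 1).symm
  refine ⟨fun j => PowerSeries.coeff j q, fun m hm => coeff_mk_pow_mul_charpolyRev A σ hm,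
    fun m hm => ?_⟩
  rw [hexp, Finset.range_eq_Ico, Finset.sum_eq_sum_Ico_succ_bot (by omega),
    Finset.sum_eq_sum_Ico_succ_bot (by omega), hq0, zero_mul, zero_add, zero_add, hq1,
    ← trSymPowZ_natCast_sub A hm, Nat.cast_one]
  congr 1
  refine Finset.sum_congr (by ext; simp) fun j hj => ?_
  rw [trSymPowZ_natCast_sub A (Finset.mem_Icc.1 hj).2]

theorem sym_trace_eq_sigma_one_formula
    (K : Type*) [Field K] (n : ℕ) (hn : 2 ≤ n) (A : Matrix (Fin n) (Fin n) K)
    (σ₁ : Matrix (Fin n) (Fin n) K →ₗ[K] K) (hId : σ₁ 1 = 0) (hA : σ₁ A ≠ 0) (s : ℕ → K)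
    (hrec : ∀ m : ℕ, 2 ≤ m → m ≤ n - 1 →
      σ₁ (A ^ m) = σ₁ A * trSymPowZ A ((m : ℤ) - 1)
        + ∑ j ∈ Finset.Icc 2 m, (-1 : K) ^ (j - 1) * s j * trSymPowZ A ((m : ℤ) - (j : ℤ))) :
    ∀ k : ℕ,
      trSymPowZ A (k : ℤ) = (σ₁ A)⁻¹ *
        (σ₁ (A ^ (k + 1)) + ∑ j ∈ Finset.Icc 2 (n - 1),
            (-1 : K) ^ j * s j * trSymPowZ A ((k : ℤ) + 1 - (j : ℤ))) := by
  obtain ⟨p, hp, hexp⟩ := map_pow_eq_sum_trSymPowZ A σ₁ hId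
  have hps : ∀ m : ℕ, 2 ≤ m → m ≤ n - 1 → p m = (-1 : K) ^ (m - 1) * s m := by
    intro m
    induction m using Nat.strong_induction_on with
    | _ m ih =>
      intro hm2 hmn
      have h := (hexp m (by omega)).symm.trans (hrec m hm2 hmn)
      obtain ⟨l, rfl⟩ := Nat.exists_eq_add_of_le' (show 1 ≤ m by omega)
      have hlower : ∑ j ∈ Finset.Icc 2 l, p j * trSymPowZ A (((l + 1 : ℕ) : ℤ) - (j : ℤ)) =
          ∑ j ∈ Finset.Icc 2 l,
            (-1 : K) ^ (j - 1) * s j * trSymPowZ A (((l + 1 : ℕ) : ℤ) - (j : ℤ)) := by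
        refine Finset.sum_congr rfl fun j hj => ?_
        obtain ⟨hj2, hjl⟩ := Finset.mem_Icc.1 hj
        rw [ih j (by omega) hj2 (by omega)]
      rw [Finset.sum_Icc_succ_top hm2, Finset.sum_Icc_succ_top hm2, hlower] at h
      simpa [trSymPowZ, trSymPow_zero] using h
  intro k
  have hneg : ∑ j ∈ Finset.Icc 2 (n - 1),
      (-1 : K) ^ j * s j * trSymPowZ A ((k : ℤ) + 1 - (j : ℤ)) =
        -∑ j ∈ Finset.Icc 2 (k + 1), p j * trSymPowZ A ((k : ℤ) + 1 - (j : ℤ)) := by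
    have hextend (N : ℕ) (hN : N ≤ n + k)
        (hz : ∀ j, N < j → p j * trSymPowZ A ((k : ℤ) + 1 - (j : ℤ)) = 0) :
        ∑ j ∈ Finset.Icc 2 N, p j * trSymPowZ A ((k : ℤ) + 1 - (j : ℤ)) =
          ∑ j ∈ Finset.Icc 2 (n + k), p j * trSymPowZ A ((k : ℤ) + 1 - (j : ℤ)) := by
      refine Finset.sum_subset (Finset.Icc_subset_Icc_right hN) fun j hj hjN => hz j ?_
      simp only [Finset.mem_Icc] at hj hjN
      omega
    rw [hextend (k + 1) (by omega) fun j hj => by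
        rw [trSymPowZ_of_neg A (by omega), mul_zero],
      ← hextend (n - 1) (by omega) fun j hj => by rw [hp j (by omega), zero_mul],
      ← Finset.sum_neg_distrib]
    refine Finset.sum_congr rfl fun j hj => ?_
    obtain ⟨hj2, hjn⟩ := Finset.mem_Icc.1 hj
    obtain ⟨l, rfl⟩ := Nat.exists_eq_add_of_le' (show 1 ≤ j by omega)
    rw [hps _ hj2 hjn, Nat.add_sub_cancel, pow_succ]
    ring
  have h := hexp (k + 1) (by omega)
  push_cast at h
  rw [add_sub_cancel_right] at h
  rw [hneg, h, add_neg_cancel_right, inv_mul_cancel_left₀ hA]
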